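/- For p, q ∈ ℝ^d, define C(p, q) = {(W, α) : α = (α₁, α₂) with α₁ > 0, α₂ > 0, W = [p/α₁, q/α₂] ∈ ℝ^{d×2}}. Then the infimum over (W, α) ∈ C(p, q) of max{‖W‖_max, ‖α‖_∞} equals max{‖p‖_∞, ‖q‖_∞}^{1/2}, where ‖W‖_max is the largest absolute value of an entry of W and ‖·‖_∞ is the ℓ∞ norm on vectors. -/

import Mathlib

open scoped BigOperators

noncomputable def relu (x : ℝ) : ℝ := max x 0

/-- Output of a two-layer ReLU network: `(XW)₊ α`. -/
noncomputable def nnOut {N D M : Type*} [Fintype N] [Fintype D] [Fintype M]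
    (X : Matrix N D ℝ) (W : Matrix D M ℝ) (a : M → ℝ) : N → ℝ :=
  ((X * W).map relu).mulVec a

/-- Entrywise max norm of a matrix. -/
noncomputable def maxNorm {D M : Type*} [Fintype D] [Fintype M] (W : Matrix D M ℝ) : ℝ :=
  ⨆ i, ⨆ j, |W i j|

/-- Frobenius norm of a matrix. -/
noncomputable def frobNorm {D M : Type*} [Fintype D] [Fintype M] (W : Matrix D M ℝ) : ℝ :=
  Real.sqrt (∑ i, ∑ j, (W i j) ^ 2)

/-- Euclidean (ℓ2) norm of a vector. -/
noncomputable def l2norm {M : Type*} [Fintype M] (v : M → ℝ) : ℝ :=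
  Real.sqrt (∑ i, (v i) ^ 2)

/-- ℓ∞ norm of a vector. -/
noncomputable def linfNorm {M : Type*} [Fintype M] (v : M → ℝ) : ℝ :=
  ⨆ i, |v i|

/-- Operator norm (largest singular value) of a matrix, as the supremum of
`‖W v‖₂` over the Euclidean unit ball. -/
noncomputable def opNorm {D M : Type*} [Fintype D] [Fintype M] (W : Matrix D M ℝ) : ℝ :=
  ⨆ v : {v : M → ℝ // l2norm v ≤ 1}, l2norm (W.mulVec v.1)

/-- The `i`-th column of a matrix. -/
def mcol {D M R : Type*} (W : Matrix D M R) (i : M) : D → R := fun r => W r i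

/-- Regularized solution set `O_R(λ)`. -/
def solSet {N D M : Type*} [Fintype N] [Fintype D] [Fintype M]
    (X : Matrix N D ℝ) (y : N → ℝ)
    (R : Matrix D M ℝ → ℝ) (Rv : (M → ℝ) → ℝ) (lam : ℝ) :
    Set (Matrix D M ℝ × (M → ℝ)) :=
  {p | nnOut X p.1 p.2 = y ∧ R p.1 ≤ 1 / lam ∧ Rv p.2 ≤ 1 / lam}

/-- Hyperplane arrangement pattern `1(Xh ≥ 0)` of a vector `h`. -/
noncomputable def pattern {N D : Type*} [Fintype N] [Fintype D]
    (X : Matrix N D ℝ) (h : D → ℝ) : N → Bool :=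
  fun i => decide (0 ≤ X.mulVec h i)

/-- The set `C(p, q) = {([p/α₁, q/α₂], (α₁, α₂)) : α₁, α₂ > 0}`. -/
def Cpq {d : ℕ} (p q : Fin d → ℝ) : Set (Matrix (Fin d) (Fin 2) ℝ × (Fin 2 → ℝ)) :=
  {Wa | 0 < Wa.2 0 ∧ 0 < Wa.2 1 ∧
        (∀ r, Wa.1 r 0 = p r / Wa.2 0) ∧ (∀ r, Wa.1 r 1 = q r / Wa.2 1)}

lemma aux_le_linf {M : Type*} [Fintype M] (v : M → ℝ) (i : M) : |v i| ≤ linfNorm v :=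
  le_ciSup (f := fun i => |v i|) (Set.finite_range _).bddAbove i

lemma aux_le_maxNorm {D M : Type*} [Fintype D] [Fintype M] (W : Matrix D M ℝ) (i : D) (j : M) :
    |W i j| ≤ maxNorm W :=
  (le_ciSup (f := fun j => |W i j|) (Set.finite_range _).bddAbove j).trans
    (le_ciSup (f := fun i => ⨆ j, |W i j|) (Set.finite_range _).bddAbove i)

lemma aux_linf_nonneg {M : Type*} [Fintype M] (v : M → ℝ) : 0 ≤ linfNorm v :=
  Real.iSup_nonneg fun _ => abs_nonneg _

/-- `inf_{(W,α) ∈ C(p,q)} max{‖W‖_max, ‖α‖_∞} = max{‖p‖_∞, ‖q‖_∞}^{1/2}`. -/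
theorem Cpq_inf_maxNorm {d : ℕ} (p q : Fin d → ℝ) :
    sInf {r : ℝ | ∃ Wa ∈ Cpq p q, r = max (maxNorm Wa.1) (linfNorm Wa.2)} =
      Real.sqrt (max (linfNorm p) (linfNorm q)) := by
  set S := {r : ℝ | ∃ Wa ∈ Cpq p q, r = max (maxNorm Wa.1) (linfNorm Wa.2)} with hS
  set m := max (linfNorm p) (linfNorm q) with hm
  have hm0 : 0 ≤ m := (aux_linf_nonneg p).trans (le_max_left _ _)
  have hlow : ∀ r ∈ S, Real.sqrt m ≤ r := by
    rintro r ⟨⟨W, a⟩, ⟨h0, h1, hp, hq⟩, hr⟩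
    dsimp only at h0 h1 hp hq hr
    have hr0 : 0 ≤ r := by
      rw [hr]; exact (aux_linf_nonneg a).trans (le_max_right _ _)
    have hW : ∀ i j, |W i j| ≤ r := fun i j => by
      rw [hr]; exact (aux_le_maxNorm W i j).trans (le_max_left _ _)
    have ha : ∀ j, |a j| ≤ r := fun j => by
      rw [hr]; exact (aux_le_linf a j).trans (le_max_right _ _)
    apply Real.sqrt_le_iff.2 ⟨hr0, ?_⟩
    rw [pow_two]
    apply max_le
    · refine Real.iSup_le (fun i => ?_) (mul_nonneg hr0 hr0)
      have h : p i = W i 0 * a 0 := by rw [hp i]; field_simp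
      rw [h, abs_mul]
      exact mul_le_mul (hW _ _) (ha _) (abs_nonneg _) hr0
    · refine Real.iSup_le (fun i => ?_) (mul_nonneg hr0 hr0)
      have h : q i = W i 1 * a 1 := by rw [hq i]; field_simp
      rw [h, abs_mul]
      exact mul_le_mul (hW _ _) (ha _) (abs_nonneg _) hr0
  have hup : ∀ s, Real.sqrt m < s → ∃ r ∈ S, r ≤ s := by
    intro s hs
    have hs0 : 0 < s := (Real.sqrt_nonneg m).trans_lt hs
    have hms : m ≤ s * s := by
      have := (Real.sqrt_le_left hs0.le).1 hs.le
      rwa [pow_two] at this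
    have key : ∀ x : ℝ, |x| ≤ m → |x / s| ≤ s := fun x hx => by
      rw [abs_div, abs_of_pos hs0, div_le_iff₀ hs0]; exact hx.trans hms
    refine ⟨_, ⟨(Matrix.of fun i j => (if j = 0 then p i else q i) / s, fun _ => s),
      ⟨hs0, hs0, fun r => by simp, fun r => by simp⟩, rfl⟩, ?_⟩
    apply max_le
    · refine Real.iSup_le (fun i => Real.iSup_le (fun j => ?_) hs0.le) hs0.le
      apply key
      split_ifs
      · exact (aux_le_linf p i).trans (le_max_left _ _)
      · exact (aux_le_linf q i).trans (le_max_right _ _)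
    · exact Real.iSup_le (fun i => (abs_of_pos hs0).le) hs0.le
  obtain ⟨r0, hr0, -⟩ := hup (Real.sqrt m + 1) (by linarith)
  apply le_antisymm
  · refine le_of_forall_gt_imp_ge_of_dense fun s hs => ?_
    obtain ⟨r, hr, hrs⟩ := hup s hs
    exact (csInf_le ⟨_, hlow⟩ hr).trans hrs
  · exact le_csInf ⟨r0, hr0⟩ hlow
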